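/- For each d ∈ ℤ_+, each t ≥ 2^{-8} and each ξ ∈ 𝕋^d one has H_t(0) · exp( -256(π³ + 1024π e^{-π/64}) e^{-4π²t} |ξ|² ) ≤ H_t(ξ) ≤ H_t(0) · exp( -(16/(1+4√2)) e^{-4π²t} |ξ|² ). -/

import Mathlib

open scoped ENNReal Real BigOperators
open Real

/-- The one-dimensional Theta function `θ_t(ζ) = Σ_{k∈ℤ} exp(-π(k-ζ)²t)`. -/
noncomputable def theta (t ζ : ℝ) : ℝ :=
  ∑' k : ℤ, Real.exp (-π * ((k : ℝ) - ζ) ^ 2 * t)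

/-- The d-dimensional Theta function `Θ_t(ξ) = Π_j θ_t(ξ_j)`. -/
noncomputable def bigTheta (d : ℕ) (t : ℝ) (ξ : Fin d → ℝ) : ℝ :=
  ∏ j, theta t (ξ j)

/-- The discrete normalized Gaussian kernel `g_t(n) = Θ_{1/t}(0)⁻¹ exp(-π|n|²/t)`. -/
noncomputable def gauss (d : ℕ) (t : ℝ) (n : Fin d → ℤ) : ℝ :=
  (bigTheta d (1 / t) 0)⁻¹ * Real.exp (-π * (∑ j, ((n j : ℝ)) ^ 2) / t)

/-- The convolution operator `G_t f(x) = Σ_n g_t(n) f(x-n)` on ℤ^d. -/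
noncomputable def gConv (d : ℕ) (t : ℝ) (f : (Fin d → ℤ) → ℂ) (x : Fin d → ℤ) : ℂ :=
  ∑' n : Fin d → ℤ, (gauss d t n : ℂ) * f (x - n)

/-- The ℓ^p norm (valued in ℝ≥0∞) of an ℝ≥0∞-valued function on ℤ^d. -/
noncomputable def lpNorm (d : ℕ) (p : ℝ) (F : (Fin d → ℤ) → ℝ≥0∞) : ℝ≥0∞ :=
  (∑' x : Fin d → ℤ, F x ^ p) ^ (1 / p)

/-- The heat kernel on the torus 𝕋^d (identified with [-1/2,1/2)^d):
`H_t(ξ) = (4πt)^{-d/2} Σ_{n∈ℤ^d} exp(-|n-ξ|²/(4t))`. -/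
noncomputable def heat (d : ℕ) (t : ℝ) (ξ : Fin d → ℝ) : ℝ :=
  (4 * π * t) ^ (-(d : ℝ) / 2) *
    ∑' n : Fin d → ℤ, Real.exp (-(∑ j, ((n j : ℝ) - ξ j) ^ 2) / (4 * t))

open HurwitzZeta in
lemma hk_hasSum (t : ℝ) (ht : 0 < t) (x : ℝ) :
    HasSum (fun n : ℤ => Real.exp (-((n : ℝ) - x) ^ 2 / (4 * t)))
      (evenKernel (x : UnitAddCircle) (1 / (4 * π * t))) := by
  have h := hasSum_int_evenKernel (-x) (t := 1 / (4 * π * t)) (by positivity)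
  have e : ((-x : ℝ) : UnitAddCircle) = -(x : UnitAddCircle) := by simp
  rw [e, evenKernel_neg] at h
  convert h using 3 with n
  field_simp
  ring

open HurwitzZeta in
lemma hk_pois (t : ℝ) (ht : 0 < t) : ∃ N : ℝ, 0 < N ∧ ∀ x : ℝ,
    evenKernel (x : UnitAddCircle) (1 / (4 * π * t)) =
      N * cosKernel (x : UnitAddCircle) (4 * π * t) := by
  refine ⟨1 / (1 / (4 * π * t)) ^ (1 / 2 : ℝ), by positivity, fun x => ?_⟩
  rw [evenKernel_functional_equation, one_div_one_div]

open HurwitzZeta in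
lemma hk_cos (t : ℝ) (ht : 0 < t) (x : ℝ) :
    HasSum (fun n : ℕ => 2 * Real.cos (2 * π * x * (n + 1)) *
      Real.exp (-4 * π ^ 2 * t) ^ ((n + 1) ^ 2)) (cosKernel (x : UnitAddCircle) (4 * π * t) - 1) := by
  convert hasSum_nat_cosKernel₀ x (t := 4 * π * t) (by positivity) using 3 with n
  rw [← Real.exp_nat_mul]
  congr 1
  push_cast
  ring

/-- `Σ q^{k²} ≤ q/(1-q³)`. -/
lemma hk_geo (q : ℝ) (hq : 0 < q) (hq1 : q < 1) :
    Summable (fun n : ℕ => q ^ ((n + 1) ^ 2)) ∧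
      ∑' n : ℕ, q ^ ((n + 1) ^ 2) ≤ q / (1 - q ^ 3) := by
  have h3 : q ^ 3 < 1 := pow_lt_one₀ hq.le hq1 (by norm_num)
  have hg : HasSum (fun n : ℕ => q * (q ^ 3) ^ n) (q / (1 - q ^ 3)) := by
    simpa [div_eq_mul_inv] using (hasSum_geometric_of_lt_one (by positivity) h3).mul_left q
  have hle : ∀ n : ℕ, q ^ ((n + 1) ^ 2) ≤ q * (q ^ 3) ^ n := by
    intro n
    rw [← pow_mul, ← pow_succ']
    apply pow_le_pow_of_le_one hq.le hq1.le
    rcases n with _ | n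
    · simp
    · nlinarith
  have hs : Summable (fun n : ℕ => q ^ ((n + 1) ^ 2)) :=
    Summable.of_nonneg_of_le (fun n => by positivity) hle hg.summable
  exact ⟨hs, hs.tsum_le_tsum hle hg.summable |>.trans hg.tsum_eq.le⟩

lemma hk_q (t : ℝ) (ht : (2 : ℝ) ^ (-8 : ℤ) ≤ t) : Real.exp (-4 * π ^ 2 * t) ≤ 0.86 := by
  have h1 : (1 : ℝ) / 256 ≤ t := by norm_num at ht ⊢; exact ht
  have hp := Real.pi_gt_d2
  have h2 : 4 * π ^ 2 * t ≥ 0.154 := by nlinarith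
  have h3 := Real.quadratic_le_exp_of_nonneg (x := 0.154) (by norm_num)
  have h4 : Real.exp (-4 * π ^ 2 * t) ≤ Real.exp (-0.154) := Real.exp_le_exp.2 (by linarith)
  refine h4.trans ?_
  rw [Real.exp_neg, inv_le_comm₀ (Real.exp_pos _) (by norm_num)]
  norm_num at h3 ⊢
  linarith

open HurwitzZeta in
lemma hk_upper (t : ℝ) (ht : (2 : ℝ) ^ (-8 : ℤ) ≤ t) (x : ℝ) (hx : |x| ≤ 1 / 2) :
    cosKernel (x : UnitAddCircle) (4 * π * t) ≤ cosKernel ((0 : ℝ) : UnitAddCircle) (4 * π * t) *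
      Real.exp (-(16 / (1 + 4 * Real.sqrt 2)) * Real.exp (-4 * π ^ 2 * t) * x ^ 2) := by
  have ht0 : 0 < t := lt_of_lt_of_le (by positivity) ht
  have hq86 := hk_q t ht
  have c0 := hk_cos t ht0 0
  have cx := hk_cos t ht0 x
  have hq0 : 0 < Real.exp (-4 * π ^ 2 * t) := Real.exp_pos _
  generalize Real.exp (-4 * π ^ 2 * t) = q at *
  generalize cosKernel (x : UnitAddCircle) (4 * π * t) = A at *
  generalize cosKernel ((0 : ℝ) : UnitAddCircle) (4 * π * t) = B at *
  obtain ⟨hs, hle⟩ := hk_geo q hq0 (by linarith)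
  have hB : B - 1 = 2 * ∑' n : ℕ, q ^ ((n + 1) ^ 2) := by
    rw [← c0.tsum_eq, ← tsum_mul_left]; simp
  have hS : q / (1 - q ^ 3) ≤ 2.5 := by
    have : q ^ 3 ≤ 0.86 ^ 3 := by gcongr
    rw [div_le_iff₀ (by norm_num at this ⊢; linarith)]
    norm_num at this ⊢; linarith
  have hS0 : 0 ≤ ∑' n : ℕ, q ^ ((n + 1) ^ 2) := tsum_nonneg fun n => by positivity
  have hsq : (1.4 : ℝ) ≤ Real.sqrt 2 := Real.le_sqrt_of_sq_le (by norm_num)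
  have hB6 : B ≤ 1 + 4 * Real.sqrt 2 := by linarith
  have hBpos : 0 < B := by linarith
  have hd := c0.sub cx
  have h0 := hd.summable.le_tsum 0 (fun j _ => by
    have := Real.cos_le_one (2 * π * x * (j + 1))
    have h2 : 0 < q ^ ((j + 1) ^ 2) := by positivity
    simp only [mul_zero, zero_mul, Real.cos_zero]
    nlinarith)
  rw [hd.tsum_eq] at h0
  have hc := Real.cos_le_one_sub_mul_cos_sq (x := 2 * π * x) (by
    rw [abs_mul, abs_of_pos (by positivity : 0 < 2 * π)]
    nlinarith [Real.pi_pos])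
  have hc' : Real.cos (2 * π * x) ≤ 1 - 8 * x ^ 2 := by
    refine hc.trans_eq ?_
    field_simp
    ring
  have h16 : 16 * q * x ^ 2 ≤ B - A := by
    simp at h0
    nlinarith
  have hk : B * (16 / (1 + 4 * Real.sqrt 2) * q * x ^ 2) ≤ 16 * q * x ^ 2 := by
    have : B * (16 / (1 + 4 * Real.sqrt 2) * q * x ^ 2) =
      (B / (1 + 4 * Real.sqrt 2)) * (16 * q * x ^ 2) := by ring
    rw [this]
    apply mul_le_of_le_one_left (by positivity)
    rw [div_le_one (by positivity)]
    exact hB6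
  have he := Real.add_one_le_exp (-(16 / (1 + 4 * Real.sqrt 2)) * q * x ^ 2)
  have := mul_le_mul_of_nonneg_left he hBpos.le
  linarith

open HurwitzZeta in
lemma hk_lower1 (t : ℝ) (ht : 0 < t) (x : ℝ) (hq : Real.exp (-4 * π ^ 2 * t) ≤ 1 / 8) :
    cosKernel ((0 : ℝ) : UnitAddCircle) (4 * π * t) ≤ cosKernel (x : UnitAddCircle) (4 * π * t) *
      Real.exp (16 * π ^ 2 * Real.exp (-4 * π ^ 2 * t) * x ^ 2) := by
  have c0 := hk_cos t ht 0
  have cx := hk_cos t ht x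
  have hq0 : 0 < Real.exp (-4 * π ^ 2 * t) := Real.exp_pos _
  generalize Real.exp (-4 * π ^ 2 * t) = q at *
  generalize cosKernel (x : UnitAddCircle) (4 * π * t) = A at *
  generalize cosKernel ((0 : ℝ) : UnitAddCircle) (4 * π * t) = B at *
  obtain ⟨hs, hle⟩ := hk_geo q hq0 (by linarith)
  have hS : q / (1 - q ^ 3) ≤ 1 / 4 := by
    have : q ^ 3 ≤ (1 / 8) ^ 3 := by gcongr
    rw [div_le_iff₀ (by norm_num at this ⊢; linarith)]
    norm_num at this ⊢; linarith
  have hA : 1 / 2 ≤ A := by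
    have h1 : -(2 * ∑' n : ℕ, q ^ ((n + 1) ^ 2)) ≤ A - 1 := by
      rw [← cx.tsum_eq, ← tsum_mul_left, ← tsum_neg]
      refine (hs.mul_left 2).neg.tsum_le_tsum (fun n => ?_) cx.summable
      have := Real.neg_one_le_cos (2 * π * x * (n + 1))
      have h2 : 0 < q ^ ((n + 1) ^ 2) := by positivity
      nlinarith
    linarith
  have hd := c0.sub cx
  have hg : HasSum (fun n : ℕ => 4 * π ^ 2 * x ^ 2 * q * (1 / 2 : ℝ) ^ n)
      (4 * π ^ 2 * x ^ 2 * q * 2) := hasSum_geometric_two.mul_left _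
  have hBA : B - 1 - (A - 1) ≤ 4 * π ^ 2 * x ^ 2 * q * 2 := by
    refine hasSum_le (fun n => ?_) hd hg
    have hc := Real.one_sub_sq_div_two_le_cos (x := 2 * π * x * (n + 1))
    have h2 : 0 < q ^ ((n + 1) ^ 2) := by positivity
    have h4 : ((n : ℝ) + 1) ^ 2 ≤ 4 ^ n := by
      have : (n : ℝ) + 1 ≤ 2 ^ n := by exact_mod_cast Nat.lt_two_pow_self
      calc ((n : ℝ) + 1) ^ 2 ≤ (2 ^ n) ^ 2 := by gcongr
        _ = 4 ^ n := by rw [← pow_mul, mul_comm, pow_mul]; norm_num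
    have h5 : q ^ ((n + 1) ^ 2) ≤ q * (1 / 8) ^ n := by
      calc q ^ ((n + 1) ^ 2) ≤ q ^ (n + 1) :=
            pow_le_pow_of_le_one hq0.le (by linarith) (by nlinarith)
        _ = q * q ^ n := pow_succ' _ _
        _ ≤ _ := by gcongr
    have h6 : ((n : ℝ) + 1) ^ 2 * q ^ ((n + 1) ^ 2) ≤ q * (1 / 2) ^ n := by
      calc ((n : ℝ) + 1) ^ 2 * q ^ ((n + 1) ^ 2) ≤ 4 ^ n * (q * (1 / 8) ^ n) := by gcongr
        _ = q * (4 * (1 / 8)) ^ n := by rw [mul_pow]; ring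
        _ = _ := by norm_num
    have h7 : 0 ≤ 4 * π ^ 2 * x ^ 2 := by positivity
    have h8 := mul_le_mul_of_nonneg_left h6 h7
    simp only [mul_zero, zero_mul, Real.cos_zero]
    nlinarith
  have he := Real.add_one_le_exp (16 * π ^ 2 * q * x ^ 2)
  have h9 := mul_le_mul_of_nonneg_left he (by linarith : 0 ≤ A)
  have h10 : 0 ≤ 16 * π ^ 2 * q * x ^ 2 := by positivity
  nlinarith

open HurwitzZeta in
lemma hk_lower2 (t : ℝ) (ht : 0 < t) (x : ℝ) :
    evenKernel ((0 : ℝ) : UnitAddCircle) (1 / (4 * π * t)) * Real.exp (-(x ^ 2 / (4 * t)))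
      ≤ evenKernel (x : UnitAddCircle) (1 / (4 * π * t)) := by
  have h1 := hk_hasSum t ht x
  have h2 := hk_hasSum t ht (-x)
  have e : ((-x : ℝ) : UnitAddCircle) = -(x : UnitAddCircle) := by simp
  rw [e, evenKernel_neg] at h2
  have h0 := ((hk_hasSum t ht 0).mul_right (Real.exp (-(x ^ 2 / (4 * t))))).mul_left 2
  have := hasSum_le (fun n => ?_) h0 (h1.add h2)
  · linarith
  · have a1 : Real.exp (-((n : ℝ) - x) ^ 2 / (4 * t)) =
        Real.exp (-((n : ℝ) - 0) ^ 2 / (4 * t)) * Real.exp (-(x ^ 2 / (4 * t))) *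
          Real.exp (n * x / (2 * t)) := by
      rw [← Real.exp_add, ← Real.exp_add]; congr 1; field_simp; ring
    have a2 : Real.exp (-((n : ℝ) - -x) ^ 2 / (4 * t)) =
        Real.exp (-((n : ℝ) - 0) ^ 2 / (4 * t)) * Real.exp (-(x ^ 2 / (4 * t))) *
          Real.exp (-(n * x / (2 * t))) := by
      rw [← Real.exp_add, ← Real.exp_add]; congr 1; field_simp; ring
    rw [a1, a2, ← mul_add, mul_comm 2]
    gcongr
    have := Real.one_le_cosh (n * x / (2 * t))
    rw [Real.cosh_eq] at this
    linarith

open HurwitzZeta in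
lemma hk_one (t : ℝ) (ht : (2 : ℝ) ^ (-8 : ℤ) ≤ t) (x : ℝ) (hx : |x| ≤ 1 / 2) :
    evenKernel ((0 : ℝ) : UnitAddCircle) (1 / (4 * π * t)) *
      Real.exp (-(256 * (π ^ 3 + 1024 * π * Real.exp (-π / 64))) *
        Real.exp (-4 * π ^ 2 * t) * x ^ 2) ≤ evenKernel (x : UnitAddCircle) (1 / (4 * π * t)) ∧
    evenKernel (x : UnitAddCircle) (1 / (4 * π * t)) ≤
      evenKernel ((0 : ℝ) : UnitAddCircle) (1 / (4 * π * t)) *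
      Real.exp (-(16 / (1 + 4 * Real.sqrt 2)) * Real.exp (-4 * π ^ 2 * t) * x ^ 2) := by
  have ht0 : 0 < t := lt_of_lt_of_le (by positivity) ht
  have h1 : (1 : ℝ) / 256 ≤ t := by norm_num at ht ⊢; exact ht
  obtain ⟨N, hN, hP⟩ := hk_pois t ht0
  have hp := Real.pi_gt_three
  have hC : 256 * π ^ 3 ≤ 256 * (π ^ 3 + 1024 * π * Real.exp (-π / 64)) := by
    have : 0 < 1024 * π * Real.exp (-π / 64) := by positivity
    linarith
  generalize 256 * (π ^ 3 + 1024 * π * Real.exp (-π / 64)) = C at *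
  have hq0 : 0 < Real.exp (-4 * π ^ 2 * t) := Real.exp_pos _
  constructor
  · rcases le_total (Real.exp (-4 * π ^ 2 * t)) (1 / 8) with hq | hq
    · rw [hP, hP, mul_assoc N]
      refine mul_le_mul_of_nonneg_left ?_ hN.le
      have hl := hk_lower1 t ht0 x hq
      have hl' : cosKernel ((0 : ℝ) : UnitAddCircle) (4 * π * t) *
          Real.exp (-(16 * π ^ 2 * Real.exp (-4 * π ^ 2 * t) * x ^ 2)) ≤
          cosKernel (x : UnitAddCircle) (4 * π * t) := by
        rw [Real.exp_neg, ← div_eq_mul_inv, div_le_iff₀ (Real.exp_pos _)]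
        exact hl
      refine le_trans ?_ hl'
      have hB : 0 ≤ cosKernel ((0 : ℝ) : UnitAddCircle) (4 * π * t) := by
        have h := (hk_hasSum t ht0 0).nonneg (fun n => (Real.exp_pos _).le)
        rw [hP] at h
        exact nonneg_of_mul_nonneg_right h hN
      refine mul_le_mul_of_nonneg_left (Real.exp_le_exp.2 ?_) hB
      have : 16 * π ^ 2 ≤ C := by nlinarith [sq_nonneg π]
      have h3 : 0 ≤ Real.exp (-4 * π ^ 2 * t) * x ^ 2 := by positivity
      nlinarith
    · refine le_trans ?_ (hk_lower2 t ht0 x)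
      have h := (hk_hasSum t ht0 0).nonneg (fun n => (Real.exp_pos _).le)
      refine mul_le_mul_of_nonneg_left (Real.exp_le_exp.2 ?_) h
      have hC2 : 512 ≤ C := by
        have : (3 : ℝ) ^ 3 ≤ π ^ 3 := by gcongr
        linarith
      have h5 : x ^ 2 / (4 * t) ≤ 64 * x ^ 2 := by
        rw [div_le_iff₀ (by positivity)]
        nlinarith [sq_nonneg x]
      have h6 : 64 ≤ C * Real.exp (-4 * π ^ 2 * t) := by nlinarith
      have h7 := mul_le_mul_of_nonneg_right h6 (sq_nonneg x)
      linarith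
  · rw [hP, hP, mul_assoc N]
    exact mul_le_mul_of_nonneg_left (hk_upper t ht x hx) hN.le

lemma hk_mul {ι κ : Type*} {f : ι → ℝ} {g : κ → ℝ} {a b : ℝ} (hf : HasSum f a) (hg : HasSum g b)
    (hf0 : ∀ n, 0 ≤ f n) (hg0 : ∀ n, 0 ≤ g n) :
    HasSum (fun p : ι × κ => f p.1 * g p.2) (a * b) :=
  hf.mul hg (hf.summable.mul_of_nonneg hg.summable hf0 hg0)

lemma hk_prod : ∀ (d : ℕ) (f : Fin d → ℤ → ℝ) (a : Fin d → ℝ), (∀ j n, 0 ≤ f j n) →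
    (∀ j, HasSum (f j) (a j)) → HasSum (fun n : Fin d → ℤ => ∏ j, f j (n j)) (∏ j, a j) := by
  intro d
  induction d with
  | zero =>
    intro f a _ _
    simp
  | succ d ih =>
    intro f a h0 hs
    have i : HasSum (fun n : Fin d → ℤ => ∏ j, f j.succ (n j)) (∏ j : Fin d, a j.succ) := ih (fun j => f j.succ) (fun j => a j.succ) (fun j => h0 _) (fun j => hs _)
    have hm := hk_mul (hs 0) i (h0 0)
      (fun n => Finset.prod_nonneg fun j _ => h0 j.succ (n j))
    rw [Fin.prod_univ_succ, ← (Fin.consEquiv (fun _ : Fin (d + 1) => ℤ)).hasSum_iff]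
    convert hm using 2 with p
    simp [Fin.prod_univ_succ, Fin.consEquiv]

open HurwitzZeta in
lemma hk_heat (d : ℕ) (t : ℝ) (ht : 0 < t) (ξ : Fin d → ℝ) :
    heat d t ξ = (4 * π * t) ^ (-(d : ℝ) / 2) *
      ∏ j, evenKernel ((ξ j : ℝ) : UnitAddCircle) (1 / (4 * π * t)) := by
  unfold heat
  congr 1
  rw [← (hk_prod d _ _ (fun j n => (Real.exp_pos _).le) (fun j => hk_hasSum t ht (ξ j))).tsum_eq]
  congr 1
  ext n
  rw [← Real.exp_sum, ← Finset.sum_div, Finset.sum_neg_distrib]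

/-- Large-time two-sided bounds for the heat kernel on 𝕋^d: for `t ≥ 2^{-8}` and `ξ ∈ 𝕋^d`,
`H_t(0) exp(-256(π³ + 1024π e^{-π/64}) e^{-4π²t}|ξ|²) ≤ H_t(ξ)
  ≤ H_t(0) exp(-(16/(1+4√2)) e^{-4π²t}|ξ|²)`. -/
theorem heat_kernel_large_time (d : ℕ) (hd : 0 < d) (t : ℝ) (ht : (2 : ℝ) ^ (-8 : ℤ) ≤ t)
    (ξ : Fin d → ℝ) (hξ : ∀ j, ξ j ∈ Set.Ico (-(1/2) : ℝ) (1/2)) :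
    heat d t 0 * Real.exp (-(256 * (π ^ 3 + 1024 * π * Real.exp (-π / 64))) *
        Real.exp (-4 * π ^ 2 * t) * ∑ j, ξ j ^ 2) ≤ heat d t ξ ∧
      heat d t ξ ≤ heat d t 0 *
        Real.exp (-(16 / (1 + 4 * Real.sqrt 2)) * Real.exp (-4 * π ^ 2 * t) * ∑ j, ξ j ^ 2) := by
  have ht0 : 0 < t := lt_of_lt_of_le (by positivity) ht
  have H := fun j => hk_one t ht (ξ j) (abs_le.2 ⟨(hξ j).1, (hξ j).2.le⟩)
  have P : ∀ x : ℝ, 0 ≤ HurwitzZeta.evenKernel (x : UnitAddCircle) (1 / (4 * π * t)) := fun x =>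
    (hk_hasSum t ht0 x).nonneg (fun n => (Real.exp_pos _).le)
  have hc : 0 ≤ (4 * π * t) ^ (-(d : ℝ) / 2) := by positivity
  rw [hk_heat d t ht0, hk_heat d t ht0]
  simp only [Finset.mul_sum, Real.exp_sum, mul_assoc ((4 * π * t) ^ (-(d : ℝ) / 2)),
    ← Finset.prod_mul_distrib, Pi.zero_apply]
  constructor
  · refine mul_le_mul_of_nonneg_left (Finset.prod_le_prod (fun j _ => ?_) fun j _ => (H j).1) hc
    exact mul_nonneg (P 0) (Real.exp_pos _).le
  · exact mul_le_mul_of_nonneg_left (Finset.prod_le_prod (fun j _ => P _) fun j _ => (H j).2) hc
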